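/- arXiv:2404.11430 — 9 statements merged into one kernel-verified Lean document; each statement's English description precedes it below -/
import Mathlib

section
/- Let E be a set, let A₁, A₂, … be subsets of E, and let μ be a finitely additive nonnegative measure on E. Suppose there exists n ∈ ℕ such that for any n pairwise distinct indices m₁, …, mₙ ∈ ℕ the intersection A_{m₁} ∩ ⋯ ∩ A_{mₙ} is empty. Then for every δ > 0 the set {m ∈ ℕ : μ(A_m) ≥ δ} is finite. -/
/-- A finitely additive nonnegative measure on a set `E`: a real-valued function on the
power set of `E` which vanishes on `∅`, is nonnegative, and is additive on disjoint sets. -/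
def IsFinAddMeasure {E : Type*} (μ : Set E → ℝ) : Prop :=
  μ ∅ = 0 ∧ (∀ S : Set E, 0 ≤ μ S) ∧
    ∀ S T : Set E, Disjoint S T → μ (S ∪ T) = μ S + μ T

/-- If every point of `S` lies in at most `k` of the sets `A m`, `m ∈ F`, then the measures of
the traces of these sets on `S` sum to at most `k * μ S`. -/
theorem IsFinAddMeasure.sum_inter_le {E ι : Type*} {μ : Set E → ℝ} (hμ : IsFinAddMeasure μ)
    (A : ι → Set E) (F : Finset ι) (S : Set E) (k : ℝ)
    (hk : ∀ x ∈ S, ((F : Set ι) ∩ {m | x ∈ A m}).ncard ≤ k) :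
    ∑ m ∈ F, μ (A m ∩ S) ≤ k * μ S := by
  classical
  obtain ⟨hempty, hnonneg, hadd⟩ := hμ
  have hsplit (S T : Set E) : μ S = μ (S ∩ T) + μ (S \ T) := by
    rw [← hadd _ _ Set.disjoint_sdiff_inter.symm, Set.inter_union_sdiff]
  induction F using Finset.induction_on generalizing S k with
  | empty =>
    rcases S.eq_empty_or_nonempty with rfl | ⟨x, hx⟩
    · simp [hempty]
    · have hk0 : 0 ≤ k := by simpa using hk x hx
      simpa using mul_nonneg hk0 (hnonneg S)
  | insert a F ha ih =>
    have hin := ih (S ∩ A a) (k - 1) fun x hx => by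
      have h := hk x hx.1
      rw [Finset.coe_insert, Set.insert_inter_of_mem (show a ∈ {m | x ∈ A m} from hx.2),
        Set.ncard_insert_of_notMem (fun h => ha h.1) (F.finite_toSet.inter_of_left _)] at h
      push_cast at h
      linarith
    have hout := ih (S \ A a) k fun x hx => by
      have h := hk x hx.1
      rwa [Finset.coe_insert,
        Set.insert_inter_of_notMem (show a ∉ {m | x ∈ A m} from hx.2)] at h
    have hsum : ∑ m ∈ F, μ (A m ∩ S) =
        ∑ m ∈ F, μ (A m ∩ (S ∩ A a)) + ∑ m ∈ F, μ (A m ∩ (S \ A a)) := by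
      rw [← Finset.sum_add_distrib]
      refine Finset.sum_congr rfl fun m _ => ?_
      rw [hsplit (A m ∩ S) (A a), Set.inter_assoc, Set.inter_sdiff_assoc]
    rw [Finset.sum_insert ha, hsum, hsplit S (A a), Set.inter_comm (A a) S]
    linarith

theorem stmt_0 {E : Type*} (μ : Set E → ℝ) (hμ : IsFinAddMeasure μ)
    (A : ℕ → Set E) (n : ℕ)
    (hA : ∀ m : Fin n → ℕ, Function.Injective m → (⋂ i, A (m i)) = ∅)
    (δ : ℝ) (hδ : 0 < δ) :
    {m : ℕ | δ ≤ μ (A m)}.Finite := by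
  by_contra hinf
  obtain ⟨N, hN⟩ := exists_nat_gt (n * μ Set.univ / δ)
  obtain ⟨F, hF, rfl⟩ := Set.Infinite.exists_subset_card_eq hinf N
  have hle := hμ.sum_inter_le A F Set.univ n fun x _ => by
    by_contra! hlt
    obtain ⟨t, ht, htn⟩ := Set.exists_subset_card_eq (Nat.cast_lt.mp hlt).le
    have htfin : t.Finite := F.finite_toSet.subset (ht.trans Set.inter_subset_left)
    have hcard : htfin.toFinset.card = n := by rw [← Set.ncard_eq_toFinset_card t htfin, htn]
    let e := htfin.toFinset.orderEmbOfFin hcard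
    have hx : x ∈ ⋂ i, A (e i) := Set.mem_iInter.mpr fun i =>
      (ht (htfin.mem_toFinset.mp (htfin.toFinset.orderEmbOfFin_mem hcard i))).2
    rw [hA e e.injective] at hx
    exact hx
  have hge : F.card * δ ≤ ∑ m ∈ F, μ (A m ∩ Set.univ) := by
    rw [← nsmul_eq_mul]
    exact Finset.card_nsmul_le_sum _ _ _ fun m hm => by simpa using hF hm
  rw [div_lt_iff₀ hδ] at hN
  linarith
end

section
/- Let E be a set and μ a finitely additive nonnegative measure on E with μ(E) ≤ 1. Let δ > 0 and k ∈ ℕ with k ≥ 2 and kδ > 1 + δ, and let B₁, …, B_k be subsets of E with μ(B_i) ≥ δ for every i ∈ {1,…,k}. Then there exist indices i < j in {1,…,k} such that μ(B_i ∩ B_j) > δ/(2^k − k). -/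
namespace IsFinAddMeasure

variable {E ι : Type*} {μ : Set E → ℝ}

theorem mono (hμ : IsFinAddMeasure μ) {S T : Set E} (h : S ⊆ T) : μ S ≤ μ T := by
  have h1 := hμ.2.2 S (T \ S) Set.disjoint_sdiff_right
  rw [Set.union_sdiff_cancel h] at h1
  linarith [hμ.2.1 (T \ S)]

theorem union_add_inter (hμ : IsFinAddMeasure μ) (S T : Set E) :
    μ (S ∪ T) + μ (S ∩ T) = μ S + μ T := by
  have h1 := hμ.2.2 S (T \ S) Set.disjoint_sdiff_right
  have h2 := hμ.2.2 (T ∩ S) (T \ S) (Set.disjoint_sdiff_right.mono_left Set.inter_subset_right)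
  rw [Set.union_sdiff_self] at h1
  rw [Set.inter_union_sdiff, Set.inter_comm] at h2
  linarith

theorem biUnion_le (hμ : IsFinAddMeasure μ) (s : Finset ι) (B : ι → Set E) :
    μ (⋃ i ∈ s, B i) ≤ ∑ i ∈ s, μ (B i) := by
  classical
  induction s using Finset.induction_on with
  | empty => simp [hμ.1]
  | insert a s ha ih =>
    rw [Finset.set_biUnion_insert, Finset.sum_insert ha]
    linarith [hμ.union_add_inter (B a) (⋃ i ∈ s, B i), hμ.2.1 (B a ∩ ⋃ i ∈ s, B i)]

/-- A Bonferroni inequality for sets whose pairwise intersections have measure at most `c`. -/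
theorem sum_le_biUnion_add (hμ : IsFinAddMeasure μ) (s : Finset ι) (B : ι → Set E) (c : ℝ)
    (hc : ∀ i j, i ≠ j → μ (B i ∩ B j) ≤ c) :
    ∑ i ∈ s, μ (B i) ≤ μ (⋃ i ∈ s, B i) + s.card.choose 2 * c := by
  classical
  induction s using Finset.induction_on with
  | empty => simp [hμ.1]
  | insert a s ha ih =>
    have h1 : μ (B a ∩ ⋃ i ∈ s, B i) ≤ s.card * c := by
      rw [Set.inter_iUnion₂]
      refine (hμ.biUnion_le s fun i => B a ∩ B i).trans ?_
      rw [← nsmul_eq_mul]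
      exact Finset.sum_le_card_nsmul _ _ _ fun i hi =>
        hc a i fun h => ha (h ▸ hi)
    rw [Finset.set_biUnion_insert, Finset.sum_insert ha, Finset.card_insert_of_notMem ha,
      Nat.choose_succ_succ' s.card 1, Nat.choose_one_right]
    push_cast
    linarith [hμ.union_add_inter (B a) (⋃ i ∈ s, B i)]

end IsFinAddMeasure

theorem Nat.choose_two_add_self_lt_two_pow (k : ℕ) : k.choose 2 + k < 2 ^ k := by
  induction k with
  | zero => simp
  | succ n ih =>
    rw [Nat.choose_succ_succ' n 1, Nat.choose_one_right, pow_succ, one_add_one_eq_two]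
    have := Nat.lt_two_pow_self (n := n)
    omega

theorem stmt_1 {E : Type*} (μ : Set E → ℝ) (hμ : IsFinAddMeasure μ)
    (hμ1 : μ Set.univ ≤ 1) (δ : ℝ) (hδ : 0 < δ) (k : ℕ) (hk : 2 ≤ k)
    (hkδ : 1 + δ < k * δ) (B : Fin k → Set E) (hB : ∀ i, δ ≤ μ (B i)) :
    ∃ i j : Fin k, i < j ∧ δ / (2 ^ k - k) < μ (B i ∩ B j) := by
  by_contra! h
  have hc : ∀ i j, i ≠ j → μ (B i ∩ B j) ≤ δ / (2 ^ k - k) := by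
    intro i j hij
    rcases lt_or_gt_of_ne hij with hlt | hlt
    · exact h i j hlt
    · rw [Set.inter_comm]
      exact h j i hlt
  have h1 := hμ.sum_le_biUnion_add Finset.univ B _ hc
  have h2 : k * δ ≤ ∑ i, μ (B i) := by
    simpa using Finset.card_nsmul_le_sum Finset.univ (fun i => μ (B i)) δ fun i _ => hB i
  have h3 := hμ.mono (Set.subset_univ (⋃ i ∈ Finset.univ, B i))
  have h4 : (k.choose 2 : ℝ) + k < 2 ^ k := by
    exact_mod_cast k.choose_two_add_self_lt_two_pow
  have h5 : (k.choose 2 : ℝ) * (δ / (2 ^ k - k)) ≤ δ := by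
    have hpos : (0 : ℝ) < 2 ^ k - k := by linarith [(k.choose 2).cast_nonneg (α := ℝ)]
    rw [← mul_div_assoc, div_le_iff₀ hpos, mul_comm]
    exact mul_le_mul_of_nonneg_left (by linarith) hδ.le
  rw [Finset.card_univ, Fintype.card_fin] at h1
  linarith
end

section
/- If a metric space (M,d) has the FLTP, then M has the LTP. -/
/-- `M̃ = {(x,y) ∈ M × M : x ≠ y}`. -/
def Mtilde (M : Type*) : Type _ := {p : M × M // p.1 ≠ p.2}

/-- `Γ_A = {(x,y) ∈ M̃ : x ∈ A or y ∈ A}`. -/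
def Gamma {M : Type*} (A : Set M) : Set (Mtilde M) :=
  {p : Mtilde M | p.val.1 ∈ A ∨ p.val.2 ∈ A}

/-- The metric space `M` has the FLTP. -/
def FLTP (M : Type*) [MetricSpace M] : Prop :=
  ∀ μ : Set (Mtilde M) → ℝ, IsFinAddMeasure μ →
    ∀ ε : ℝ, 0 < ε → ∀ (n : ℕ) (f : Fin n → M → ℝ),
      (∀ (i : Fin n) (x y : M), |f i x - f i y| ≤ dist x y) →
      ∃ (A : Set M) (u v : M), μ (Gamma A) < ε ∧ u ∈ A ∧ v ∈ A ∧ u ≠ v ∧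
        ∀ (i : Fin n), ∀ x ∉ A, ∀ y ∉ A,
          (1 - ε) * (f i x - f i y + dist u v) ≤ dist x u + dist y v

/-- The metric space `M` has the LTP. -/
def LTP (M : Type*) [MetricSpace M] : Prop :=
  ∀ N : Set M, N.Finite → ∀ ε : ℝ, 0 < ε →
    ∃ u v : M, u ≠ v ∧ ∀ x ∈ N, ∀ y ∈ N,
      (1 - ε) * (dist x y + dist u v) ≤ dist x u + dist y v

/-- A finite sum of point masses of equal weight is a finitely additive measure. -/
lemma isFinAddMeasure_sum_indicator {E ι : Type*} (s : Finset ι) (g : ι → E) {c : ℝ}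
    (hc : 0 ≤ c) :
    IsFinAddMeasure fun S : Set E => ∑ i ∈ s, S.indicator (fun _ => c) (g i) := by
  refine ⟨by simp, fun S => Finset.sum_nonneg fun i _ => Set.indicator_nonneg (fun _ _ => hc) _,
    fun S T hST => ?_⟩
  simp only [Set.indicator_union_of_disjoint hST, Finset.sum_add_distrib]

lemma FLTP.nontrivial {M : Type*} [MetricSpace M] (h : FLTP M) : Nontrivial M := by
  obtain ⟨_, u, v, _, _, _, huv, _⟩ :=
    h (fun _ => 0) ⟨rfl, fun _ => le_rfl, fun _ _ _ => by simp⟩ 1 one_pos 0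
      (fun i => i.elim0) (fun i => i.elim0)
  exact ⟨u, v, huv⟩

theorem stmt_6 {M : Type*} [MetricSpace M] (h : FLTP M) : LTP M := by
  intro N hN ε hε
  have := h.nontrivial
  choose w hw using fun x : M => exists_ne x
  let g : M → Mtilde M := fun x => ⟨(x, w x), (hw x).symm⟩
  let s := hN.toFinset
  obtain ⟨A, u, v, hA, -, -, huv, hf⟩ :=
    h _ (isFinAddMeasure_sum_indicator s g hε.le) ε hε s.card
      (fun i x => dist x (s.equivFin.symm i)) (fun _ x y => abs_dist_sub_le x y _)
  have hNA : ∀ x ∈ N, x ∉ A := by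
    intro x hx hxA
    have hle := Finset.single_le_sum
      (f := fun x => (Gamma A).indicator (fun _ => ε) (g x))
      (fun i _ => Set.indicator_nonneg (fun _ _ => hε.le) _) (hN.mem_toFinset.mpr hx)
    have hg : g x ∈ Gamma A := Or.inl hxA
    rw [Set.indicator_of_mem hg] at hle
    exact absurd hA hle.not_gt
  refine ⟨u, v, huv, fun x hx y hy => ?_⟩
  simpa using hf (s.equivFin ⟨y, hN.mem_toFinset.mpr hy⟩) x (hNA x hx) y (hNA y hy)
end

section
/- Let f : M₁ → ℝ satisfy |f(p) − f(q)| ≤ d(p,q) for all p, q ∈ M₁. If k, l ∈ ℕ with k ≠ l and |f(a_k) − f(c_k)| ≥ 1, then |f(a_l) − f(c_l)| ≤ 1. -/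
/-- The distance on the metric space `M₁` with underlying set `ℕ × Fin 3`, writing
`a_k = (k, 0)`, `b_k = (k, 1)`, `c_k = (k, 2)`:  `d1 p p = 0`; `d1 (a_k) (c_k) = 2`;
`d1 (a_k) (b_l) = d1 (b_k) (b_l) = d1 (c_k) (b_l) = 2` whenever `k < l`; and the distance
between two distinct points is `1` in all other cases (`d1` is symmetric). -/
def d1 (p q : ℕ × Fin 3) : ℝ :=
  if p = q then 0
  else if (p.2 = 0 ∧ q.2 = 2 ∧ p.1 = q.1) ∨ (p.2 = 2 ∧ q.2 = 0 ∧ p.1 = q.1)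
      ∨ (q.2 = 1 ∧ p.1 < q.1) ∨ (p.2 = 1 ∧ q.1 < p.1) then 2
  else 1

theorem stmt_8 (f : ℕ × Fin 3 → ℝ) (hf : ∀ p q : ℕ × Fin 3, |f p - f q| ≤ d1 p q)
    (k l : ℕ) (hkl : k ≠ l) (h : 1 ≤ |f (k, 0) - f (k, 2)|) :
    |f (l, 0) - f (l, 2)| ≤ 1 := by
  have cross (i j : Fin 3) (hi : i ≠ 1) (hj : j ≠ 1) : |f (k, i) - f (l, j)| ≤ 1 := by
    simpa [d1, hkl, hi, hj] using hf (k, i) (l, j)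
  have haa := abs_le.1 (cross 0 0 (by decide) (by decide))
  have hac := abs_le.1 (cross 0 2 (by decide) (by decide))
  have hca := abs_le.1 (cross 2 0 (by decide) (by decide))
  have hcc := abs_le.1 (cross 2 2 (by decide) (by decide))
  rw [abs_le]
  rcases le_abs.1 h with h | h <;> constructor <;> linarith
end

section
/- Let k ∈ ℕ and let f : M₁ → ℝ satisfy |f(p) − f(q)| ≤ d(p,q) for all p, q ∈ M₁ and |f(a_l) − f(c_l)| ≤ 1 for all l ≥ k. Then for all x, y ∈ M₁∖{a_k, b_k}: f(x) − f(y) + d(a_k,b_k) ≤ d(x,a_k) + d(y,b_k), i.e. f(x) − f(y) + 1 ≤ d(x,a_k) + d(y,b_k). -/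
theorem d1_le_two (p q : ℕ × Fin 3) : d1 p q ≤ 2 := by
  unfold d1
  split_ifs <;> norm_num

theorem d1_eq_one_or_two {p q : ℕ × Fin 3} (h : p ≠ q) : d1 p q = 1 ∨ d1 p q = 2 := by
  unfold d1
  rw [if_neg h]
  split_ifs <;> simp

/-- Two points at distance `1` from `a_k` and `b_k` respectively are at distance at most `1`,
unless they are `a_l` and `c_l` in some order for some `l ≥ k`. -/
theorem d1_le_one_or_of_d1_eq_one {k : ℕ} {x y : ℕ × Fin 3}
    (hxa : d1 x (k, 0) = 1) (hyb : d1 y (k, 1) = 1) (hx : x ≠ (k, 0)) (hy : y ≠ (k, 0)) :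
    d1 x y ≤ 1 ∨ ∃ l, k ≤ l ∧
      ((x = (l, 0) ∧ y = (l, 2)) ∨ (x = (l, 2) ∧ y = (l, 0))) := by
  obtain ⟨m, i⟩ := x
  obtain ⟨n, j⟩ := y
  by_contra! hne
  obtain ⟨hd, hl⟩ := hne
  have hl := hl m
  fin_cases i <;> fin_cases j <;> simp [d1] at * <;> grind

theorem stmt_9 (k : ℕ) (f : ℕ × Fin 3 → ℝ)
    (hf : ∀ p q : ℕ × Fin 3, |f p - f q| ≤ d1 p q)
    (hfl : ∀ l : ℕ, k ≤ l → |f (l, 0) - f (l, 2)| ≤ 1) :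
    ∀ x y : ℕ × Fin 3, x ≠ (k, 0) → x ≠ (k, 1) → y ≠ (k, 0) → y ≠ (k, 1) →
      f x - f y + d1 (k, 0) (k, 1) ≤ d1 x (k, 0) + d1 y (k, 1) := by
  intro x y hxa _ hya hyb
  have hab : d1 (k, 0) (k, 1) = 1 := by simp [d1]
  have hxy := (abs_le.mp (hf x y)).2
  have h2 := d1_le_two x y
  rcases d1_eq_one_or_two hxa with h | h <;> rcases d1_eq_one_or_two hyb with h' | h'
  · rcases d1_le_one_or_of_d1_eq_one h h' hxa hya with h1 | ⟨l, hl, ⟨rfl, rfl⟩ | ⟨rfl, rfl⟩⟩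
    · linarith
    · linarith [(abs_le.mp (hfl l hl)).2]
    · linarith [(abs_le.mp (hfl l hl)).1]
  all_goals linarith
end

section
/- Let 0 < α < 1/11 and let f₁, f₂, g : M₁ → ℝ satisfy: f₁(b₁) = g(b₁) = 0; |f_i(x) − f_i(y)| + |g(x) − g(y)| ≤ d(x,y) for all x, y ∈ M₁ and i ∈ {1,2}; there exist p, q ∈ M₁ with p ≠ q and |g(p) − g(q)| ≥ (1−α)·d(p,q); and both (f₁+g)(a₁) − (f₁+g)(c₁) > 2(1−α) and (f₁−g)(a₁) − (f₁−g)(c₁) > 2(1−α). Then there exists k ∈ ℕ such that |f₂(a_l) − f₂(a_{l+1})| < 10α for all l ≥ k. -/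
theorem d1_of_ne_one {k : ℕ} {x : ℕ × Fin 3} (h : x.2 ≠ 1) (hk : x.1 ≠ k) {i : Fin 3}
    (hi : i ≠ 1) : d1 (k, i) x = 1 := by
  obtain ⟨n, j⟩ := x
  have : ¬ k = n := fun e => hk e.symm
  simp_all [d1]

theorem d1_b_of_le {k l : ℕ} (h : l ≤ k) {i : Fin 3} (hi : i ≠ 1) : d1 (k, i) (l, 1) = 1 := by
  simp [d1, hi, h]

theorem d1_b_b {k l : ℕ} (h : k ≠ l) : d1 (k, 1) (l, 1) = 2 := by
  rcases lt_or_gt_of_ne h with h' | h' <;> simp [d1, h, h']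

theorem abs_sub_lt_of_midpoint {X : Type*} {f g : X → ℝ} {a c x : X} {α : ℝ}
    (hax : |f a - f x| + |g a - g x| ≤ 1) (hcx : |f c - f x| + |g c - g x| ≤ 1)
    (hplus : 2 * (1 - α) < (f a + g a) - (f c + g c))
    (hminus : 2 * (1 - α) < (f a - g a) - (f c - g c)) : |g x - g a| < α := by
  have h1 := le_abs_self (f a - f x)
  have h2 := neg_abs_le (f c - f x)
  rw [abs_lt]
  constructor <;>
    linarith [le_abs_self (g a - g x), neg_abs_le (g a - g x),
      le_abs_self (g c - g x), neg_abs_le (g c - g x)]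

theorem stmt_11 (α : ℝ) (hα0 : 0 < α) (hα1 : α < 1 / 11)
    (f₁ f₂ g : ℕ × Fin 3 → ℝ)
    (hf₁0 : f₁ (1, 1) = 0) (hg0 : g (1, 1) = 0)
    (hf₁ : ∀ x y : ℕ × Fin 3, |f₁ x - f₁ y| + |g x - g y| ≤ d1 x y)
    (hf₂ : ∀ x y : ℕ × Fin 3, |f₂ x - f₂ y| + |g x - g y| ≤ d1 x y)
    (hg : ∃ p q : ℕ × Fin 3, p ≠ q ∧ (1 - α) * d1 p q ≤ |g p - g q|)
    (hplus : 2 * (1 - α) < (f₁ (1, 0) + g (1, 0)) - (f₁ (1, 2) + g (1, 2)))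
    (hminus : 2 * (1 - α) < (f₁ (1, 0) - g (1, 0)) - (f₁ (1, 2) - g (1, 2))) :
    ∃ k : ℕ, ∀ l : ℕ, k ≤ l → |f₂ (l, 0) - f₂ (l + 1, 0)| < 10 * α := by
  have hS : ∀ x : ℕ × Fin 3, x.2 ≠ 1 → |g x - g (1, 0)| < α := by
    rintro ⟨n, j⟩ hj
    by_cases hn : n = 1
    · subst hn
      fin_cases j
      · simpa using hα0
      · simp at hj
      · have h := hf₁ (1, 0) (1, 2)
        have hd : d1 (1, 0) (1, 2) = 2 := by simp [d1]
        rw [hd] at h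
        have := le_abs_self (f₁ (1, 0) - f₁ (1, 2))
        change |g (1, 2) - g (1, 0)| < α
        rw [abs_lt]
        constructor <;> linarith [le_abs_self (g (1, 0) - g (1, 2)),
          neg_abs_le (g (1, 0) - g (1, 2))]
    · refine abs_sub_lt_of_midpoint (c := (1, 2)) ?_ ?_ hplus hminus
      · exact (hf₁ _ _).trans_eq (d1_of_ne_one hj hn (by decide))
      · exact (hf₁ _ _).trans_eq (d1_of_ne_one hj hn (by decide))
  obtain ⟨l, hl⟩ : ∃ l : ℕ, 1 - 2 * α ≤ |g (l, 1) - g (1, 0)| := by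
    by_contra! hcon
    obtain ⟨p, q, hpq, h⟩ := hg
    have htri := abs_sub_le (g p) (g (1, 0)) (g q)
    rw [abs_sub_comm (g (1, 0))] at htri
    have hall : ∀ x : ℕ × Fin 3, |g x - g (1, 0)| < 1 - 2 * α := by
      rintro ⟨n, j⟩
      by_cases hj : j = 1
      · exact hj ▸ hcon n
      · linarith [hS (n, j) hj]
    have hp := hall p
    have hq := hall q
    rcases d1_eq_one_or_two hpq with hd | hd <;> rw [hd] at h
    · by_cases hp1 : p.2 = 1
      · by_cases hq1 : q.2 = 1
        · obtain ⟨m, i⟩ := p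
          obtain ⟨n, j⟩ := q
          subst hp1 hq1
          rw [d1_b_b (fun e => hpq (by rw [e]))] at hd
          norm_num at hd
        · linarith [hS q hq1]
      · linarith [hS p hp1]
    · linarith
  have hclose : ∀ k, l ≤ k → |f₂ (k, 0) - f₂ (l, 1)| < 3 * α := fun k hk => by
    have h := hf₂ (k, 0) (l, 1)
    rw [d1_b_of_le hk (by decide)] at h
    have h1 := hS (k, 0) (by simp)
    have h2 := abs_sub_le (g (l, 1)) (g (k, 0)) (g (1, 0))
    rw [abs_sub_comm (g (l, 1)) (g (k, 0))] at h2
    linarith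
  refine ⟨l, fun k hk => ?_⟩
  have h := abs_sub_le (f₂ (k, 0)) (f₂ (l, 1)) (f₂ (k + 1, 0))
  rw [abs_sub_comm (f₂ (l, 1))] at h
  linarith [hclose k hk, hclose (k + 1) (by omega)]
end

section
/- The metric space M₂ has the SLTP; in fact, for every finite subset N of M₂ there exist u, v ∈ M₂ with u ≠ v such that d(x,y) + d(u,v) ≤ d(x,u) + d(y,v) for all x, y ∈ N and 2d(u,v) + d(x,y) + d(z,w) ≤ d(x,u) + d(y,u) + d(z,v) + d(w,v) for all x, y, z, w ∈ N. -/
/-- The underlying set of the metric space `M₂`: the points `a₁ = Sum.inl 0` and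
`a₂ = Sum.inl 1`, together with `b_{m+1} = Sum.inr (m, 0)` and `c_{m+1} = Sum.inr (m, 1)`
for `m : ℕ` (so `Sum.inr (m, j)` represents the point with index `m + 1 ≥ 1` of the paper). -/
abbrev M2 : Type := Fin 2 ⊕ (ℕ × Fin 2)

/-- The point `a₁` of `M₂`. -/
def pa1 : M2 := Sum.inl 0
/-- The point `a₂` of `M₂`. -/
def pa2 : M2 := Sum.inl 1
/-- The point `b_{m+1}` of `M₂` (indices of the paper start from `1`). -/
def pb (m : ℕ) : M2 := Sum.inr (m, 0)
/-- The point `c_{m+1}` of `M₂` (indices of the paper start from `1`). -/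
def pc (m : ℕ) : M2 := Sum.inr (m, 1)

/-- Adjacency (distance-one) relation of `M₂`: `d(a₁, b_{2k-1}) = d(a₂, b_{2k}) = 1` and
`d(c_k, b_l) = 1` whenever `k ≤ l`.  In terms of the formal indices (shifted by one),
`a₁` is adjacent to `b`-points with even formal index, `a₂` to `b`-points with odd formal
index, and `c` with formal index `k` is adjacent to `b` with formal index `l` iff `k ≤ l`. -/
def Adj2 : M2 → M2 → Prop
  | Sum.inl i, Sum.inr q => q.2 = 0 ∧ ((i = 0 ∧ Even q.1) ∨ (i = 1 ∧ Odd q.1))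
  | Sum.inr q, Sum.inl i => q.2 = 0 ∧ ((i = 0 ∧ Even q.1) ∨ (i = 1 ∧ Odd q.1))
  | Sum.inr p, Sum.inr q =>
      (p.2 = 1 ∧ q.2 = 0 ∧ p.1 ≤ q.1) ∨ (p.2 = 0 ∧ q.2 = 1 ∧ q.1 ≤ p.1)
  | Sum.inl _, Sum.inl _ => False

open Classical in
/-- The distance of the metric space `M₂`: distinct adjacent points are at distance `1`,
all other pairs of distinct points are at distance `2`. -/
noncomputable def d2 (p q : M2) : ℝ :=
  if p = q then 0 else if Adj2 p q then 1 else 2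

theorem d2_nonneg (p q : M2) : 0 ≤ d2 p q := by
  unfold d2; split_ifs <;> norm_num

theorem d2_le_two (p q : M2) : d2 p q ≤ 2 := by
  unfold d2; split_ifs <;> norm_num

theorem one_le_d2 {p q : M2} (h : p ≠ q) : 1 ≤ d2 p q := by
  unfold d2; rw [if_neg h]; split_ifs <;> norm_num

theorem d2_pc_pb {k l : ℕ} (h : k ≤ l) : d2 (pc k) (pb l) = 1 := by
  simp [d2, pc, pb, Adj2, h]

/-- A point of `M₂` lies below the index `K` if it is one of `a₁`, `a₂`, or a `b`- or `c`-point
of formal index less than `K`. -/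
def IsBelow (K : ℕ) (x : M2) : Prop := ∀ q, x = Sum.inr q → q.1 < K

theorem IsBelow.ne_pb {K : ℕ} {x : M2} (h : IsBelow K x) : x ≠ pb K :=
  fun hx => (h _ hx).false

theorem IsBelow.d2_pc {K : ℕ} {x : M2} (h : IsBelow K x) : d2 x (pc K) = 2 := by
  have hne : x ≠ pc K := fun hx => (h _ hx).false
  have hadj : ¬ Adj2 x (pc K) := by
    rcases x with i | q
    · simp [Adj2, pc]
    · simpa [Adj2, pc] using fun _ => h q rfl
  rw [d2, if_neg hne, if_neg hadj]

theorem exists_forall_isBelow {N : Set M2} (hN : N.Finite) : ∃ K, ∀ x ∈ N, IsBelow K x := by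
  obtain ⟨B, hB⟩ := (hN.image (Sum.elim (fun _ => 0) Prod.fst)).bddAbove
  refine ⟨B + 1, ?_⟩
  rintro _ hx q rfl
  exact Nat.lt_succ_of_le (hB ⟨_, hx, rfl⟩)

theorem exists_ne_forall_d2_le {N : Set M2} (hN : N.Finite) :
    ∃ u v : M2, u ≠ v ∧
      (∀ x ∈ N, ∀ y ∈ N, d2 x y + d2 u v ≤ d2 x u + d2 y v) ∧
      (∀ x ∈ N, ∀ y ∈ N, ∀ z ∈ N, ∀ w ∈ N,
        2 * d2 u v + d2 x y + d2 z w ≤ d2 x u + d2 y u + d2 z v + d2 w v) := by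
  obtain ⟨K, hK⟩ := exists_forall_isBelow hN
  refine ⟨pc K, pb K, by simp [pc, pb], fun x hx y hy => ?_, fun x hx y hy z hz w hw => ?_⟩
  · rw [d2_pc_pb le_rfl, (hK x hx).d2_pc]
    linarith [d2_le_two x y, one_le_d2 (hK y hy).ne_pb]
  · rw [d2_pc_pb le_rfl, (hK x hx).d2_pc, (hK y hy).d2_pc]
    linarith [d2_le_two x y, d2_le_two z w, one_le_d2 (hK z hz).ne_pb, one_le_d2 (hK w hw).ne_pb]

theorem stmt_12 :
    (∀ N : Set M2, N.Finite → ∀ ε : ℝ, 0 < ε →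
      ∃ u v : M2, u ≠ v ∧
        (∀ x ∈ N, ∀ y ∈ N,
          (1 - ε) * (d2 x y + d2 u v) ≤ d2 x u + d2 y v) ∧
        (∀ x ∈ N, ∀ y ∈ N, ∀ z ∈ N, ∀ w ∈ N,
          (1 - ε) * (2 * d2 u v + d2 x y + d2 z w) ≤
            d2 x u + d2 y u + d2 z v + d2 w v)) ∧
    (∀ N : Set M2, N.Finite →
      ∃ u v : M2, u ≠ v ∧
        (∀ x ∈ N, ∀ y ∈ N, d2 x y + d2 u v ≤ d2 x u + d2 y v) ∧
        (∀ x ∈ N, ∀ y ∈ N, ∀ z ∈ N, ∀ w ∈ N,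
          2 * d2 u v + d2 x y + d2 z w ≤ d2 x u + d2 y u + d2 z v + d2 w v)) := by
  refine ⟨fun N hN ε hε => ?_, fun N hN => exists_ne_forall_d2_le hN⟩
  obtain ⟨u, v, huv, h₁, h₂⟩ := exists_ne_forall_d2_le hN
  have shrink {a : ℝ} (ha : 0 ≤ a) : (1 - ε) * a ≤ a :=
    mul_le_of_le_one_left ha (by linarith)
  refine ⟨u, v, huv, fun x hx y hy => (shrink ?_).trans (h₁ x hx y hy),
    fun x hx y hy z hz w hw => (shrink ?_).trans (h₂ x hx y hy z hz w hw)⟩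
  · linarith [d2_nonneg x y, d2_nonneg u v]
  · linarith [d2_nonneg x y, d2_nonneg u v, d2_nonneg z w]
end

section
/- Let 0 < α < 1/13 and let f : M₂ → ℝ satisfy: |f(x) − f(y)| ≤ d(x,y) for all x, y ∈ M₂; f(c₁) = 0; f(a₁) − f(a₂) > 2 − 4α; and f(b_{2n−1}) − f(b_{2n}) > 2 − 4α for infinitely many n ∈ ℕ. Then: |f(b_l)| ≤ 1 for every l; |f(c_m)| < 4α for every m; 1 − 8α < f(a₁) < 1 + 4α; −1 − 4α < f(a₂) < −1 + 8α; and f(b_{2n−1}) > −8α and f(b_{2n}) < 8α for every n. -/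
theorem d2_le_one_of_adj {p q : M2} (h : Adj2 p q) : d2 p q ≤ 1 := by
  unfold d2
  split_ifs <;> norm_num

theorem adj2_pc_pb {k l : ℕ} (h : k ≤ l) : Adj2 (pc k) (pb l) :=
  Or.inl ⟨rfl, rfl, h⟩

theorem adj2_pa1_pb (n : ℕ) : Adj2 pa1 (pb (2 * n)) :=
  ⟨rfl, Or.inl ⟨rfl, even_two_mul n⟩⟩

theorem adj2_pa2_pb (n : ℕ) : Adj2 pa2 (pb (2 * n + 1)) :=
  ⟨rfl, Or.inr ⟨rfl, odd_two_mul_add_one n⟩⟩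

theorem stmt_13 (α : ℝ) (hα0 : 0 < α) (hα1 : α < 1 / 13) (f : M2 → ℝ)
    (hLip : ∀ x y : M2, |f x - f y| ≤ d2 x y)
    (hc : f (pc 0) = 0)
    (ha : 2 - 4 * α < f pa1 - f pa2)
    (hb : {n : ℕ | 2 - 4 * α < f (pb (2 * n)) - f (pb (2 * n + 1))}.Infinite) :
    (∀ l : ℕ, |f (pb l)| ≤ 1) ∧
    (∀ m : ℕ, |f (pc m)| < 4 * α) ∧
    (1 - 8 * α < f pa1 ∧ f pa1 < 1 + 4 * α) ∧
    (-1 - 4 * α < f pa2 ∧ f pa2 < -1 + 8 * α) ∧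
    (∀ n : ℕ, -(8 * α) < f (pb (2 * n)) ∧ f (pb (2 * n + 1)) < 8 * α) := by
  have near {x y : M2} (h : Adj2 x y) : |f x - f y| ≤ 1 := (hLip x y).trans (d2_le_one_of_adj h)
  have far (x y : M2) : |f x - f y| ≤ 2 := (hLip x y).trans (d2_le_two x y)
  have b_le (l : ℕ) : |f (pb l)| ≤ 1 := by
    simpa [hc] using near (adj2_pc_pb (Nat.zero_le l))
  have b_large (m : ℕ) :
      ∃ n > m, 1 - 4 * α < f (pb (2 * n)) ∧ f (pb (2 * n + 1)) < -1 + 4 * α := by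
    obtain ⟨n, hn, hmn⟩ := hb.exists_gt m
    have h₀ := abs_le.1 (b_le (2 * n))
    have h₁ := abs_le.1 (b_le (2 * n + 1))
    rw [Set.mem_ofPred_eq] at hn
    exact ⟨n, hmn, by linarith, by linarith⟩
  obtain ⟨n, -, hn₀, hn₁⟩ := b_large 0
  have a₁_lt : f pa1 < 1 + 4 * α := by
    linarith [(abs_le.1 (far pa1 (pb (2 * n + 1)))).2]
  have lt_a₂ : -1 - 4 * α < f pa2 := by
    linarith [(abs_le.1 (far pa2 (pb (2 * n)))).1]
  refine ⟨b_le, fun m => ?_, ⟨by linarith, a₁_lt⟩, ⟨lt_a₂, by linarith⟩, fun k => ⟨?_, ?_⟩⟩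
  · obtain ⟨k, hk, hk₀, hk₁⟩ := b_large m
    have h₀ := abs_le.1 (near (adj2_pc_pb (k := m) (l := 2 * k) (by lia)))
    have h₁ := abs_le.1 (near (adj2_pc_pb (k := m) (l := 2 * k + 1) (by lia)))
    exact abs_lt.2 ⟨by linarith, by linarith⟩
  · linarith [(abs_le.1 (near (adj2_pa1_pb k))).2]
  · linarith [(abs_le.1 (near (adj2_pa2_pb k))).1]
end

section
/- Let M = {e_i + e_j : i, j ∈ ℕ} regarded as a metric subspace of ℓ¹. Let 0 < ε < 1/3, let A ⊆ M, and let u, v ∈ A with u ≠ v be such that (1−ε)(‖x − y‖₁ + ‖u − v‖₁) ≤ ‖x − u‖₁ + ‖y − v‖₁ for all x, y ∈ M∖A. Then there exists m ∈ ℕ such that the set {n ∈ ℕ : e_m + e_n ∉ A} has at most two elements. -/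
/-- The `i`-th standard unit vector of `ℓ¹ = lp (fun _ : ℕ => ℝ) 1`. -/
noncomputable def ee (i : ℕ) : lp (fun _ : ℕ => ℝ) 1 := lp.single 1 i 1

/-- The subset `M = {e_i + e_j : i, j ∈ ℕ}` of `ℓ¹`. -/
def Mset : Set (lp (fun _ : ℕ => ℝ) 1) := {x | ∃ i j : ℕ, x = ee i + ee j}

theorem sum_abs_le_norm (f : lp (fun _ : ℕ => ℝ) 1) (s : Finset ℕ) :
    ∑ t ∈ s, |f t| ≤ ‖f‖ := by
  have := lp.sum_rpow_le_norm_rpow (p := 1) (by norm_num) f s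
  simpa using this

theorem ee_apply (i t : ℕ) : ee i t = if t = i then 1 else 0 := by
  simp [ee, Pi.single_apply]

theorem norm_ee (i : ℕ) : ‖ee i‖ = 1 := by
  simp [ee, lp.norm_single]

theorem norm_ee_sub_ee_le (i j : ℕ) : ‖ee i - ee j‖ ≤ 2 := by
  have := norm_sub_le (ee i) (ee j)
  rw [norm_ee, norm_ee] at this
  linarith

theorem two_le_norm_ee_sub_ee {i j : ℕ} (hij : i ≠ j) : 2 ≤ ‖ee i - ee j‖ := by
  have := sum_abs_le_norm (ee i - ee j) {i, j}
  rw [Finset.sum_pair hij] at this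
  simp only [lp.coeFn_sub, Pi.sub_apply, ee_apply, hij, hij.symm, if_true, if_false] at this
  norm_num at this
  exact this

theorem norm_ee_add_sub_le (a b c : ℕ) : ‖(ee a + ee b) - (ee a + ee c)‖ ≤ 2 := by
  rw [add_sub_add_left_eq_sub]
  exact norm_ee_sub_ee_le b c

theorem two_le_norm_ee_add_sub (a : ℕ) {b c : ℕ} (hbc : b ≠ c) :
    2 ≤ ‖(ee a + ee b) - (ee a + ee c)‖ := by
  rw [add_sub_add_left_eq_sub]
  exact two_le_norm_ee_sub_ee hbc

theorem two_le_sum_abs_ee_add_ee (i j : ℕ) :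
    2 ≤ ∑ t ∈ ({i, j} : Finset ℕ), |ee i t + ee j t| := by
  rcases eq_or_ne i j with rfl | hij
  · norm_num [ee_apply]
  · norm_num [Finset.sum_pair hij, ee_apply, hij, hij.symm]

theorem four_le_norm_of_disjoint {i j k l : ℕ} (hik : i ≠ k) (hil : i ≠ l) (hjk : j ≠ k)
    (hjl : j ≠ l) : 4 ≤ ‖(ee i + ee j) - (ee k + ee l)‖ := by
  have hsum := sum_abs_le_norm ((ee i + ee j) - (ee k + ee l)) ({i, j} ∪ {k, l})
  have hdisj : Disjoint ({i, j} : Finset ℕ) {k, l} := by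
    simp [hik.symm, hil.symm, hjk.symm, hjl.symm]
  rw [Finset.sum_union hdisj] at hsum
  have hij : ∑ t ∈ ({i, j} : Finset ℕ), |((ee i + ee j) - (ee k + ee l)) t| =
      ∑ t ∈ ({i, j} : Finset ℕ), |ee i t + ee j t| := by
    refine Finset.sum_congr rfl fun t ht => ?_
    have htk : t ≠ k := by grind
    have htl : t ≠ l := by grind
    simp [ee_apply, htk, htl]
  have hkl : ∑ t ∈ ({k, l} : Finset ℕ), |((ee i + ee j) - (ee k + ee l)) t| =
      ∑ t ∈ ({k, l} : Finset ℕ), |ee k t + ee l t| := by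
    refine Finset.sum_congr rfl fun t ht => ?_
    have hti : t ≠ i := by grind
    have htj : t ≠ j := by grind
    rw [← abs_neg]
    simp [ee_apply, hti, htj, add_comm]
  linarith [two_le_sum_abs_ee_add_ee i j, two_le_sum_abs_ee_add_ee k l]

theorem exists_row_of_common_index {ε : ℝ} (hε : ε < 1 / 3) {A : Set (lp (fun _ : ℕ => ℝ) 1)}
    {a b c : ℕ} (hca : c ≠ a) (hbc : b ≠ c) (hv : ee a + ee c ∈ A)
    (h : ∀ x ∈ Mset, x ∉ A → ∀ y ∈ Mset, y ∉ A →
      (1 - ε) * (‖x - y‖ + ‖(ee a + ee b) - (ee a + ee c)‖) ≤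
        ‖x - (ee a + ee b)‖ + ‖y - (ee a + ee c)‖) :
    ∃ m n₁ n₂ : ℕ, ∀ n : ℕ, ee m + ee n ∉ A → n = n₁ ∨ n = n₂ := by
  by_cases hc : ∃ k, ee c + ee k ∉ A
  · obtain ⟨k, hk⟩ := hc
    refine ⟨a, k, k, fun n hn => ?_⟩
    by_contra! hnk
    have hnc : n ≠ c := by rintro rfl; exact hn hv
    have hka : k ≠ a := by rintro rfl; exact hk (add_comm (ee c) (ee k) ▸ hv)
    have key := h _ ⟨a, n, rfl⟩ hn _ ⟨c, k, rfl⟩ hk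
    have h1 := four_le_norm_of_disjoint hca.symm hka.symm hnc hnk.1
    have h2 := two_le_norm_ee_add_sub a hbc
    have h3 := norm_ee_add_sub_le a n b
    have h4 := norm_ee_add_sub_le c k a
    rw [add_comm (ee c) (ee a)] at h4
    nlinarith
  · push Not at hc
    exact ⟨c, 0, 0, fun n hn => absurd (hc n) hn⟩

theorem exists_row_of_overlap {ε : ℝ} (hε : ε < 1 / 3) {A : Set (lp (fun _ : ℕ => ℝ) 1)}
    {a b c : ℕ} (hbc : b ≠ c) (hu : ee a + ee b ∈ A) (hv : ee a + ee c ∈ A)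
    (h : ∀ x ∈ Mset, x ∉ A → ∀ y ∈ Mset, y ∉ A →
      (1 - ε) * (‖x - y‖ + ‖(ee a + ee b) - (ee a + ee c)‖) ≤
        ‖x - (ee a + ee b)‖ + ‖y - (ee a + ee c)‖) :
    ∃ m n₁ n₂ : ℕ, ∀ n : ℕ, ee m + ee n ∉ A → n = n₁ ∨ n = n₂ := by
  by_cases hca : c = a
  · refine exists_row_of_common_index hε (hca ▸ hbc) hbc.symm hu fun x hx hxA y hy hyA => ?_
    rw [norm_sub_rev x, norm_sub_rev (ee a + ee c), add_comm ‖x - _‖]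
    exact h y hy hyA x hx hxA
  · exact exists_row_of_common_index hε hca hbc hv h

theorem exists_row_of_disjoint {ε : ℝ} (hε : ε < 1 / 3) {A : Set (lp (fun _ : ℕ => ℝ) 1)}
    {a b c d : ℕ} (hac : a ≠ c) (had : a ≠ d) (hbc : b ≠ c) (hbd : b ≠ d)
    (h : ∀ x ∈ Mset, x ∉ A → ∀ y ∈ Mset, y ∉ A →
      (1 - ε) * (‖x - y‖ + ‖(ee a + ee b) - (ee c + ee d)‖) ≤
        ‖x - (ee a + ee b)‖ + ‖y - (ee c + ee d)‖) :
    ∃ m n₁ n₂ : ℕ, ∀ n : ℕ, ee m + ee n ∉ A → n = n₁ ∨ n = n₂ := by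
  by_cases hc : ∃ k, ee c + ee k ∉ A
  · obtain ⟨k, hk⟩ := hc
    refine ⟨a, c, c, fun n hn => ?_⟩
    by_contra! hnc
    have key := h _ ⟨a, n, rfl⟩ hn _ ⟨c, k, rfl⟩ hk
    have h1 : 2 ≤ ‖(ee a + ee n) - (ee c + ee k)‖ := by
      by_cases hak : a = k
      · rw [← hak, add_comm (ee c)]
        exact two_le_norm_ee_add_sub a hnc.1
      by_cases hnk : n = k
      · rw [← hnk, add_comm (ee c), add_comm (ee a)]
        exact two_le_norm_ee_add_sub n hac
      linarith [four_le_norm_of_disjoint hac hak hnc.1 hnk]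
    have h2 := four_le_norm_of_disjoint hac had hbc hbd
    have h3 := norm_ee_add_sub_le a n b
    have h4 := norm_ee_add_sub_le c k d
    nlinarith
  · push Not at hc
    exact ⟨c, 0, 0, fun n hn => absurd (hc n) hn⟩

theorem stmt_15 (ε : ℝ) (hε0 : 0 < ε) (hε1 : ε < 1 / 3)
    (A : Set (lp (fun _ : ℕ => ℝ) 1)) (hA : A ⊆ Mset)
    (u v : lp (fun _ : ℕ => ℝ) 1) (hu : u ∈ A) (hv : v ∈ A) (huv : u ≠ v)
    (h : ∀ x ∈ Mset, x ∉ A → ∀ y ∈ Mset, y ∉ A →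
      (1 - ε) * (‖x - y‖ + ‖u - v‖) ≤ ‖x - u‖ + ‖y - v‖) :
    ∃ m n₁ n₂ : ℕ, ∀ n : ℕ, ee m + ee n ∉ A → n = n₁ ∨ n = n₂ := by
  obtain ⟨a, b, rfl⟩ := hA hu
  obtain ⟨c, d, rfl⟩ := hA hv
  have overlap : ∀ {i j k : ℕ}, ee a + ee b = ee i + ee j → ee c + ee d = ee i + ee k →
      ∃ m n₁ n₂ : ℕ, ∀ n : ℕ, ee m + ee n ∉ A → n = n₁ ∨ n = n₂ := by
    intro i j k hij hik
    rw [hij] at hu huv h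
    rw [hik] at hv huv h
    exact exists_row_of_overlap hε1 (fun hjk => huv (by rw [hjk])) hu hv h
  by_cases hac : a = c
  · exact overlap rfl (by rw [hac])
  by_cases had : a = d
  · exact overlap rfl (by rw [had, add_comm])
  by_cases hbc : b = c
  · exact overlap (add_comm _ _) (by rw [hbc])
  by_cases hbd : b = d
  · exact overlap (add_comm _ _) (by rw [hbd, add_comm])
  exact exists_row_of_disjoint hε1 hac had hbc hbd h
end
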